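/- Let (Ω, 𝓕, ℙ) be a probability space, let u : ℝ → ℝ be concave and differentiable, and let P be an essentially bounded real-valued random variable. Suppose r* ∈ ℝ satisfies E[u'(P − r*)] = 1. Then for every r ∈ ℝ, E[u(P − r)] + r ≤ E[u(P − r*)] + r*; consequently the optimized certainty equivalent satisfies S(P) = E[u(P − r*)] + r*. -/

import Mathlib

open MeasureTheory

/-- A differentiable concave function lies below each of its tangent lines. -/
lemma ConcaveOn.le_add_deriv_mul_sub {u : ℝ → ℝ} (hconc : ConcaveOn ℝ Set.univ u)
    (hdiff : Differentiable ℝ u) (x y : ℝ) : u y ≤ u x + deriv u x * (y - x) := by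
  rcases lt_trichotomy x y with h | rfl | h
  · have := hconc.slope_le_deriv (Set.mem_univ x) (Set.mem_univ y) h (hdiff x)
    rw [slope_def_field, div_le_iff₀ (sub_pos.2 h)] at this
    linarith
  · simp
  · have := hconc.deriv_le_slope (Set.mem_univ y) (Set.mem_univ x) h (hdiff x)
    rw [slope_def_field, le_div_iff₀ (sub_pos.2 h)] at this
    linarith

/-- A continuous function of an essentially bounded random variable is integrable. -/
lemma Continuous.integrable_comp_of_ae_abs_le {Ω : Type*} [MeasurableSpace Ω] {μ : Measure Ω}
    [IsFiniteMeasure μ] {g : ℝ → ℝ} (hg : Continuous g) {P : Ω → ℝ} (hP : Measurable P) {C : ℝ}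
    (hC : ∀ᵐ ω ∂μ, |P ω| ≤ C) : Integrable (fun ω => g (P ω)) μ := by
  obtain ⟨K, hK⟩ := (isCompact_Icc (a := -C) (b := C)).exists_bound_of_continuousOn hg.continuousOn
  refine Integrable.of_bound (hg.measurable.comp hP).aestronglyMeasurable K ?_
  filter_upwards [hC] with ω hω
  exact hK _ (abs_le.1 hω)

/-- Let `u : ℝ → ℝ` be concave and differentiable and `P` essentially
bounded. Suppose `r* ∈ ℝ` satisfies the first-order condition `E[u'(P − r*)] = 1`. Then for
every `r`, `E[u(P − r)] + r ≤ E[u(P − r*)] + r*`; consequently the optimized certainty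
equivalent satisfies `S(P) = E[u(P − r*)] + r*`. -/
theorem oce_first_order_condition {Ω : Type*} [MeasurableSpace Ω]
    (μ : Measure Ω) [IsProbabilityMeasure μ]
    (u : ℝ → ℝ) (hconc : ConcaveOn ℝ Set.univ u) (hdiff : Differentiable ℝ u)
    (P : Ω → ℝ) (hP : Measurable P)
    (hPbdd : ∃ C : ℝ, ∀ᵐ ω ∂μ, |P ω| ≤ C)
    (rstar : ℝ) (hfoc : (∫ ω, deriv u (P ω - rstar) ∂μ) = 1) :
    (∀ r : ℝ, (∫ ω, u (P ω - r) ∂μ) + r ≤ (∫ ω, u (P ω - rstar) ∂μ) + rstar) ∧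
    sSup (Set.range fun r : ℝ => (∫ ω, u (P ω - r) ∂μ) + r)
      = (∫ ω, u (P ω - rstar) ∂μ) + rstar := by
  obtain ⟨C, hC⟩ := hPbdd
  have hu (r : ℝ) : Integrable (fun ω => u (P ω - r)) μ :=
    (hdiff.continuous.comp (continuous_sub_right r)).integrable_comp_of_ae_abs_le hP hC
  have hd : Integrable (fun ω => deriv u (P ω - rstar)) μ :=
    Integrable.of_integral_ne_zero (by rw [hfoc]; exact one_ne_zero)
  have hmax (r : ℝ) :
      (∫ ω, u (P ω - r) ∂μ) + r ≤ (∫ ω, u (P ω - rstar) ∂μ) + rstar := by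
    have hle : ∫ ω, u (P ω - r) ∂μ
        ≤ ∫ ω, (u (P ω - rstar) + deriv u (P ω - rstar) * (rstar - r)) ∂μ := by
      refine integral_mono (hu r) ((hu rstar).add (hd.mul_const _)) fun ω => ?_
      have := hconc.le_add_deriv_mul_sub hdiff (P ω - rstar) (P ω - r)
      rwa [sub_sub_sub_cancel_left] at this
    rw [integral_add (hu rstar) (hd.mul_const _), integral_mul_const, hfoc] at hle
    linarith
  refine ⟨hmax, IsGreatest.csSup_eq ⟨⟨rstar, rfl⟩, ?_⟩⟩
  rintro _ ⟨r, rfl⟩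
  exact hmax r
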